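/- Let s be a weak composition, T an s-decreasing tree, and (a,b), (c,d) tree ascents of T with a < c. Let Z and Q be the s-tree rotations of T along (a,b) and (c,d) respectively. Then the multi-inversion set difference satisfies inv(Z ∨ Q) − inv(T) = A_T(a,b) ∪ A_T(c,d) ∪ F_T(a,c), where ∨ is the join in s-weak order. -/

import Mathlib

open scoped Classical

/-- An `s`-decreasing tree with internal vertices `1,…,n` (the root is `n`), encoded by
recording, for each non-root internal vertex `v`, its parent `parent v` (an internal vertex
with a larger label, so that labels decrease away from the root) and the index `idx v` of
the child slot of `parent v` (among `0,…,s (parent v)`, left to right) containing `v`.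
Distinct internal vertices occupy distinct child slots; all remaining slots are leaves. -/
structure SDecTree (n : ℕ) (s : ℕ → ℕ) where
  parent : ℕ → ℕ
  idx : ℕ → ℕ
  parent_gt : ∀ v, 1 ≤ v → v < n → v < parent v
  parent_le : ∀ v, 1 ≤ v → v < n → parent v ≤ n
  idx_le : ∀ v, 1 ≤ v → v < n → idx v ≤ s (parent v)
  slot_inj : ∀ v w, 1 ≤ v → v < n → 1 ≤ w → w < n →
      parent v = parent w → idx v = idx w → v = w
  parent_out : ∀ v, v = 0 ∨ n ≤ v → parent v = 0
  idx_out : ∀ v, v = 0 ∨ n ≤ v → idx v = 0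

namespace SDecTree

variable {n : ℕ} {s : ℕ → ℕ}

/-- `y` is a weak ancestor of `x`, i.e. `x` is a labeled vertex of the subtree `T^y`. -/
def Descend (T : SDecTree n s) (x y : ℕ) : Prop :=
  ∃ k, T.parent^[k] x = y ∧ ∀ m ≤ k, 1 ≤ T.parent^[m] x ∧ T.parent^[m] x ≤ n

/-- `x` is a labeled vertex of the subtree `T^y_j` rooted at the `j`-th child of `y`. -/
def InSub (T : SDecTree n s) (y j x : ℕ) : Prop :=
  ∃ c, T.Descend x c ∧ T.parent c = y ∧ T.idx c = j

/-- `x` lies strictly left of `y` in the planar tree `T`. -/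
def LeftOf (T : SDecTree n s) (x y : ℕ) : Prop :=
  ∃ z j₁ j₂, j₁ < j₂ ∧ T.InSub z j₁ x ∧ T.InSub z j₂ y

/-- The cardinality `#_T(y,x)` of the pair `(y,x)`: it is `j` if `x ∈ T^y_j`
(so `0` if `x ∈ T^y_0` and `s y` if `x ∈ T^y_{s y}`), `0` if `x` is left of `y`, and
`s y` if `x` is right of `y`; it is `0` for out-of-range pairs. -/
noncomputable def card (T : SDecTree n s) (y x : ℕ) : ℕ :=
  if h : ∃ j, T.InSub y j x then h.choose
  else if 1 ≤ x ∧ x < y ∧ y ≤ n ∧ ¬ T.LeftOf x y then s y else 0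

/-- `x` is a labeled vertex of `T^a ∖ 0`, i.e. of `T^a` with `T^a_0` replaced by a leaf. -/
def InSubMinus0 (T : SDecTree n s) (a x : ℕ) : Prop :=
  x = a ∨ ∃ j, 0 < j ∧ T.InSub a j x

/-- `(a,b)` is a tree ascent of `T`. -/
def TreeAscent (T : SDecTree n s) (a b : ℕ) : Prop :=
  1 ≤ a ∧ a < b ∧ b ≤ n ∧
  (∃ i, i < s b ∧ T.InSub b i a) ∧
  (∀ e j, a < e → e < b → T.InSub e j a → j = s e) ∧
  (0 < s a → ∀ x, ¬ T.InSub a (s a) x)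

end SDecTree

/-- A multi-inversion set (encoded by its multiplicity function) is transitive:
if `a < b < c` then `#(b,a) = 0` or `#(c,a) ≥ #(c,b)`. -/
def IsTransitiveInv (I : ℕ → ℕ → ℕ) : Prop :=
  ∀ a b c, a < b → b < c → I b a = 0 ∨ I c b ≤ I c a

/-- The transitive closure of a multi-inversion set: the smallest (by inclusion, i.e.
pointwise on multiplicities) transitive multi-inversion set containing it. -/
noncomputable def tcInv (I : ℕ → ℕ → ℕ) : ℕ → ℕ → ℕ := fun y x =>
  sInf {m | ∃ J : ℕ → ℕ → ℕ, IsTransitiveInv J ∧ (∀ y' x', I y' x' ≤ J y' x') ∧ J y x = m}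

/-- Add one copy of the inversion `(b,a)` to `I`, capping the multiplicity at `s b`. -/
def addInv (s : ℕ → ℕ) (I : ℕ → ℕ → ℕ) (b a : ℕ) : ℕ → ℕ → ℕ := fun y x =>
  if y = b ∧ x = a then min (I y x + 1) (s y) else I y x

namespace SDecTree

variable {n : ℕ} {s : ℕ → ℕ}

/-- The `s`-weak order: `T ⪯ Z` iff `#_T(y,x) ≤ #_Z(y,x)` for all pairs. -/
def wle (T Z : SDecTree n s) : Prop := ∀ y x, T.card y x ≤ Z.card y x

/-- Strict `s`-weak order. -/
def wlt (T Z : SDecTree n s) : Prop := wle T Z ∧ ¬ wle Z T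

/-- Cover relation in the `s`-weak order. -/
def wcov (T Z : SDecTree n s) : Prop := wlt T Z ∧ ∀ U, wlt T U → wlt U Z → False

/-- `W` is the join of `T` and `Z` in the `s`-weak order. -/
def IsJoin (T Z W : SDecTree n s) : Prop :=
  wle T W ∧ wle Z W ∧ ∀ U, wle T U → wle Z U → wle W U

/-- `Z` is the `s`-tree rotation of `T` along the tree ascent `(a,b)`, i.e.
`inv Z = (inv T + (b,a))^tc`. -/
def IsRotation (T Z : SDecTree n s) (a b : ℕ) : Prop :=
  T.TreeAscent a b ∧
  ∀ y x, 1 ≤ x → x < y → y ≤ n → Z.card y x = tcInv (addInv s T.card b a) y x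

/-- The set `A_T(a,b)` of inversions added by a rotation producing `Z`: the pairs `(f,e)`
with `#_Z(f,e) > #_T(f,e)`. -/
def Aset (T Z : SDecTree n s) : Set (ℕ × ℕ) :=
  {p | T.card p.1 p.2 < Z.card p.1 p.2}

/-- The set `A_T(a,b)` described directly via the transitive closure. -/
def ARot (T : SDecTree n s) (a b : ℕ) : Set (ℕ × ℕ) :=
  {p | T.card p.1 p.2 < tcInv (addInv s T.card b a) p.1 p.2}

/-- The set `F_T(a,c)` (here `b` and `d` are the partners of `a` and `c` in the
respective tree ascents `(a,b)` and `(c,d)`): it is `{(d,e) : e ∈ T^a∖0}` if `b = c`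
and `a ∈ T^c_0`, and empty otherwise. -/
def Fset (T : SDecTree n s) (a b c d : ℕ) : Set (ℕ × ℕ) :=
  {p | b = c ∧ T.InSub c 0 a ∧ p.1 = d ∧ T.InSubMinus0 a p.2}

/-- `T` is an `s`-Tamari tree: `#_T(c,a) ≤ #_T(c,b)` whenever `a < b < c`. -/
def IsTamari (T : SDecTree n s) : Prop :=
  ∀ a b c, a < b → b < c → T.card c a ≤ T.card c b

/-- `(a,b)` is a Tamari tree ascent of `T`: `a` is a non-rightmost child of `b`. -/
def TamariAscent (T : SDecTree n s) (a b : ℕ) : Prop :=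
  1 ≤ a ∧ a < n ∧ T.parent a = b ∧ T.card b a < s b

/-- `Z` is the `s`-Tamari rotation of `T` along the Tamari tree ascent `(a,b)`. -/
def IsTamRotation (T Z : SDecTree n s) (a b : ℕ) : Prop :=
  T.TamariAscent a b ∧
  ∀ y x, 1 ≤ x → x < y → y ≤ n → Z.card y x = tcInv (addInv s T.card b a) y x

/-- Cover relation in the `s`-Tamari lattice. -/
def tamcov (T Z : SDecTree n s) : Prop :=
  IsTamari T ∧ IsTamari Z ∧ wlt T Z ∧ ∀ U, IsTamari U → wlt T U → wlt U Z → False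

/-- `W` is the join of `T` and `Z` in the `s`-Tamari lattice. -/
def IsTamJoin (T Z W : SDecTree n s) : Prop :=
  IsTamari W ∧ wle T W ∧ wle Z W ∧ ∀ U, IsTamari U → wle T U → wle Z U → wle W U

/-- The open interval `(T,Z)` in the `s`-weak order. -/
def OpenInterval (T Z : SDecTree n s) : Set (SDecTree n s) := {U | wlt T U ∧ wlt U Z}

/-- A set of trees forming a chain in the `s`-weak order. -/
def IsChainSet (C : Set (SDecTree n s)) : Prop :=
  C.Pairwise fun U V => wlt U V ∨ wlt V U

/-- The geometric realization of the order complex `Δ(T,Z)` of the open interval `(T,Z)`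
in the `s`-weak order: the space of finitely supported probability vectors on the vertex
set whose support is a chain of the open interval. -/
def orderComplex (T Z : SDecTree n s) : Set (SDecTree n s → ℝ) :=
  {f | (∀ U, 0 ≤ f U) ∧ (Function.support f).Finite ∧
    Function.support f ⊆ OpenInterval T Z ∧ IsChainSet (Function.support f) ∧
    ∑ᶠ U, f U = 1}

/-- The geometric realization of the order complex of the open interval `(T,Z)` in the
`s`-Tamari lattice. -/
def tamOrderComplex (T Z : SDecTree n s) : Set (SDecTree n s → ℝ) :=
  {f | (∀ U, 0 ≤ f U) ∧ (Function.support f).Finite ∧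
    Function.support f ⊆ {U | IsTamari U ∧ wlt T U ∧ wlt U Z} ∧
    IsChainSet (Function.support f) ∧ ∑ᶠ U, f U = 1}

end SDecTree

/-- The list of labels of the consecutive cover relations along a saturated chain,
recorded as a list of poset elements. -/
def labelsOf {α : Type*} (lab : α → α → ℕ) (L : List α) : List ℕ :=
  (L.zip L.tail).map fun p => lab p.1 p.2

namespace SDecTree

variable {n : ℕ} {s : ℕ → ℕ}

/-! ### Basic facts on descent in a tree -/

theorem desc_range {T : SDecTree n s} {x y : ℕ} (h : T.Descend x y) :
    1 ≤ x ∧ x ≤ n ∧ 1 ≤ y ∧ y ≤ n := by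
  obtain ⟨k, hk, hm⟩ := h
  have h0 := hm 0 (Nat.zero_le _)
  have h1 := hm k le_rfl
  rw [hk] at h1
  simp at h0
  exact ⟨h0.1, h0.2, h1.1, h1.2⟩

theorem desc_refl (T : SDecTree n s) {x : ℕ} (h1 : 1 ≤ x) (h2 : x ≤ n) : T.Descend x x :=
  ⟨0, rfl, fun m hm => by
    obtain rfl : m = 0 := by omega
    exact ⟨h1, h2⟩⟩

theorem desc_parent (T : SDecTree n s) {x : ℕ} (h1 : 1 ≤ x) (h2 : x < n) :
    T.Descend x (T.parent x) := by
  refine ⟨1, rfl, fun m hm => ?_⟩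
  have h3 := T.parent_gt x h1 h2
  have h4 := T.parent_le x h1 h2
  interval_cases m
  · exact ⟨h1, h2.le⟩
  · show 1 ≤ T.parent x ∧ T.parent x ≤ n
    omega

theorem desc_trans {T : SDecTree n s} {x y z : ℕ} (h : T.Descend x y) (h' : T.Descend y z) :
    T.Descend x z := by
  obtain ⟨k, hk, hm⟩ := h
  obtain ⟨l, hl, hm'⟩ := h'
  refine ⟨l + k, ?_, fun m hml => ?_⟩
  · rw [Function.iterate_add_apply, hk, hl]
  · by_cases hmk : m ≤ k
    · exact hm m hmk
    · obtain ⟨r, rfl⟩ : ∃ r, m = r + k := ⟨m - k, by omega⟩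
      rw [Function.iterate_add_apply, hk]
      exact hm' r (by omega)

theorem parent_pos_lt (T : SDecTree n s) {c : ℕ} (h : 1 ≤ T.parent c) : 1 ≤ c ∧ c < n := by
  by_contra hc
  have := T.parent_out c (by omega)
  omega

theorem desc_le {T : SDecTree n s} {x y : ℕ} (h : T.Descend x y) : x ≤ y := by
  obtain ⟨k, hk, hm⟩ := h
  induction k generalizing y with
  | zero => simp at hk; omega
  | succ k ih =>
    have h1 := ih rfl (fun m hmk => hm m (by omega))
    rw [Function.iterate_succ_apply'] at hk
    have h2 := hm (k+1) le_rfl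
    rw [Function.iterate_succ_apply'] at h2
    have h3 := T.parent_pos_lt h2.1
    have := T.parent_gt _ h3.1 h3.2
    omega

theorem desc_total {T : SDecTree n s} {x y z : ℕ} (h : T.Descend x y) (h' : T.Descend x z)
    (hyz : y ≤ z) : T.Descend y z := by
  obtain ⟨k, hk, hm⟩ := h
  obtain ⟨l, hl, hm'⟩ := h'
  have key : ∀ {k l y z : ℕ}, T.parent^[k] x = y → T.parent^[l] x = z →
      (∀ m ≤ l, 1 ≤ T.parent^[m] x ∧ T.parent^[m] x ≤ n) → k ≤ l → T.Descend y z := by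
    intro k l y z hk hl hm' hkl
    refine ⟨l - k, ?_, fun m hml => ?_⟩
    · rw [← hk, ← Function.iterate_add_apply, ← hl]; congr 2; omega
    · rw [← hk, ← Function.iterate_add_apply]; exact hm' _ (by omega)
  rcases le_total k l with hkl | hkl
  · exact key hk hl hm' hkl
  · have h1 := key hl hk hm hkl
    have h2 := desc_le h1
    obtain rfl : y = z := by omega
    exact h1

theorem desc_root (T : SDecTree n s) {x : ℕ} (h1 : 1 ≤ x) (h2 : x ≤ n) : T.Descend x n := by
  obtain ⟨k, hk⟩ : ∃ k, k = n - x := ⟨_, rfl⟩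
  induction k using Nat.strong_induction_on generalizing x with
  | _ k ih =>
    rcases h2.eq_or_lt with rfl | h3
    · exact T.desc_refl h1 le_rfl
    · have h4 := T.parent_gt x h1 h3
      have h5 := T.parent_le x h1 h3
      exact desc_trans (T.desc_parent h1 h3) (ih (n - T.parent x) (by omega) (by omega) h5 rfl)

/-- If `x` is a proper descendant of `y`, then it lies in some child subtree. -/
theorem desc_child {T : SDecTree n s} {x y : ℕ} (h : T.Descend x y) (hxy : x < y) :
    ∃ j, T.InSub y j x := by
  obtain ⟨k, hk, hm⟩ := h
  cases k with
  | zero => simp at hk; omega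
  | succ k =>
    exact ⟨_, T.parent^[k] x, ⟨k, rfl, fun m hmk => hm m (by omega)⟩,
      by rw [← hk, Function.iterate_succ_apply'], rfl⟩

theorem inSub_desc {T : SDecTree n s} {x y j : ℕ} (h : T.InSub y j x) (hy : 1 ≤ y) :
    T.Descend x y ∧ x < y ∧ j ≤ s y := by
  obtain ⟨c, hc, rfl, rfl⟩ := h
  have h1 := T.parent_pos_lt hy
  have h2 := T.desc_parent h1.1 h1.2
  refine ⟨desc_trans hc h2, ?_, T.idx_le c h1.1 h1.2⟩
  have := T.parent_gt c h1.1 h1.2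
  have := desc_le hc
  omega

theorem inSub_zero {T : SDecTree n s} {x j : ℕ} (h : T.InSub 0 j x) : j = 0 := by
  obtain ⟨c, hc, h1, rfl⟩ := h
  have h2 := desc_range hc
  apply T.idx_out
  by_contra h3
  have := T.parent_gt c (by omega) (by omega)
  omega

theorem inSub_of_desc {T : SDecTree n s} {x y z j : ℕ} (h : T.InSub z j y)
    (h' : T.Descend x y) : T.InSub z j x := by
  obtain ⟨c, hc, h1, h2⟩ := h
  exact ⟨c, desc_trans h' hc, h1, h2⟩

theorem child_unique {T : SDecTree n s} {x c c' : ℕ} (h : T.Descend x c) (h' : T.Descend x c')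
    (hp : T.parent c = T.parent c') (h0 : 1 ≤ T.parent c) : c = c' := by
  have key : ∀ {c c' : ℕ}, T.Descend x c → T.Descend x c' →
      T.parent c = T.parent c' → 1 ≤ T.parent c → c ≤ c' → c = c' := by
    intro c c' h h' hp h0 hcc
    by_contra hne
    have h1 := desc_total h h' hcc
    obtain ⟨k, hk, hm⟩ := h1
    cases k with
    | zero => exact hne hk
    | succ k =>
      have h2 : T.Descend (T.parent c) c' := by
        refine ⟨k, by rw [← hk, Function.iterate_succ_apply], fun m hmk => ?_⟩
        rw [← Function.iterate_succ_apply]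
        exact hm _ (by omega)
      have h3 := desc_le h2
      have h4 := T.parent_pos_lt (c := c') (by omega)
      have := T.parent_gt c' h4.1 h4.2
      omega
  rcases le_total c c' with hcc | hcc
  · exact key h h' hp h0 hcc
  · exact (key h' h hp.symm (by omega) hcc).symm

theorem inSub_unique {T : SDecTree n s} {x y j j' : ℕ} (h : T.InSub y j x)
    (h' : T.InSub y j' x) : j = j' := by
  rcases Nat.eq_zero_or_pos y with rfl | hy
  · rw [inSub_zero h, inSub_zero h']
  · obtain ⟨c, hc, h1, h2⟩ := h
    obtain ⟨c', hc', h1', h2'⟩ := h'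
    have := child_unique hc hc' (by omega) (by omega)
    subst this
    omega

theorem inSub_lift {T : SDecTree n s} {x w z j : ℕ} (h : T.InSub z j x) (h' : T.Descend x w)
    (hwz : w < z) : T.InSub z j w := by
  have h1 := (inSub_desc h (by omega)).1
  obtain ⟨j', hj'⟩ := desc_child (desc_total h' h1 hwz.le) hwz
  rwa [inSub_unique h (inSub_of_desc hj' h')]

theorem leftOf_pos {T : SDecTree n s} {x y : ℕ} (h : T.LeftOf x y) :
    ∃ z j₁ j₂, 1 ≤ z ∧ j₁ < j₂ ∧ T.InSub z j₁ x ∧ T.InSub z j₂ y := by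
  obtain ⟨z, j1, j2, h1, h2, h3⟩ := h
  refine ⟨z, j1, j2, ?_, h1, h2, h3⟩
  by_contra hz
  obtain rfl : z = 0 := by omega
  have := inSub_zero h3
  omega

theorem leftOf_not_desc {T : SDecTree n s} {x y : ℕ} (h : T.LeftOf x y) :
    ¬ T.Descend x y ∧ ¬ T.Descend y x := by
  obtain ⟨z, j1, j2, h1, h2, h3⟩ := h
  refine ⟨fun h => ?_, fun h => ?_⟩
  · have := inSub_unique h2 (inSub_of_desc h3 h); omega
  · have := inSub_unique h3 (inSub_of_desc h2 h); omega

theorem leftOf_trans {T : SDecTree n s} {x y z : ℕ} (h : T.LeftOf x y) (h' : T.LeftOf y z) :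
    T.LeftOf x z := by
  obtain ⟨v, i1, i2, hv, hi, h1, h2⟩ := leftOf_pos h
  obtain ⟨w, j1, j2, hw, hj, h3, h4⟩ := leftOf_pos h'
  rcases lt_trichotomy v w with hlt | rfl | hlt
  · exact ⟨w, j1, j2, hj,
      inSub_of_desc (inSub_lift h3 (inSub_desc h2 hv).1 hlt) (inSub_desc h1 hv).1, h4⟩
  · have := inSub_unique h2 h3
    exact ⟨v, i1, j2, by omega, h1, h4⟩
  · exact ⟨v, i1, i2, hi, h1,
      inSub_of_desc (inSub_lift h2 (inSub_desc h3 hw).1 hlt) (inSub_desc h4 hw).1⟩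

theorem leftOf_irrefl {T : SDecTree n s} {x : ℕ} (h : T.LeftOf x x) : False := by
  obtain ⟨v, i1, i2, hi, h1, h2⟩ := h
  have := inSub_unique h1 h2
  omega

theorem trichotomy (T : SDecTree n s) {x y : ℕ} (h1 : 1 ≤ x) (hxy : x < y) (h2 : y ≤ n) :
    T.Descend x y ∨ T.LeftOf x y ∨ T.LeftOf y x := by
  by_cases hd : T.Descend x y
  · exact Or.inl hd
  right
  have hex : ∃ z, T.Descend x z ∧ T.Descend y z :=
    ⟨n, T.desc_root h1 (by omega), T.desc_root (by omega) h2⟩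
  obtain ⟨hzx, hzy⟩ := Nat.find_spec hex
  have hmin := fun m => Nat.find_min (H := hex) (m := m)
  set z := Nat.find hex
  have hyz : y < z := by
    have := desc_le hzy
    rcases this.eq_or_lt with h | h
    · rw [← h] at hzx; exact absurd hzx hd
    · exact h
  obtain ⟨i, hi⟩ := desc_child hzx (by omega)
  obtain ⟨j, hj⟩ := desc_child hzy hyz
  rcases lt_trichotomy i j with hlt | rfl | hlt
  · exact Or.inl ⟨z, i, j, hlt, hi, hj⟩
  · exfalso
    obtain ⟨c, hc, hp, hk⟩ := hi
    obtain ⟨c', hc', hp', hk'⟩ := hj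
    have r1 := T.parent_pos_lt (c := c) (by omega)
    have r2 := T.parent_pos_lt (c := c') (by omega)
    have := T.slot_inj c c' r1.1 r1.2 r2.1 r2.2 (by omega) (by omega)
    subst this
    have := T.parent_gt c r1.1 r1.2
    exact hmin c (by omega) ⟨hc, hc'⟩
  · exact Or.inr ⟨z, j, i, hlt, hj, hi⟩

theorem card_inSub {T : SDecTree n s} {x y j : ℕ} (h : T.InSub y j x) : T.card y x = j := by
  have hex : ∃ j, T.InSub y j x := ⟨j, h⟩
  rw [card, dif_pos hex]
  exact inSub_unique hex.choose_spec h

theorem card_left {T : SDecTree n s} {x y : ℕ} (h : T.LeftOf x y) (hxy : x < y) :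
    T.card y x = 0 := by
  rw [card, dif_neg, if_neg]
  · tauto
  · rintro ⟨j, hj⟩
    exact (leftOf_not_desc h).1 (inSub_desc hj (by omega)).1

theorem leftOf_range {T : SDecTree n s} {x y : ℕ} (h : T.LeftOf x y) :
    (1 ≤ x ∧ x ≤ n) ∧ (1 ≤ y ∧ y ≤ n) := by
  obtain ⟨z, j1, j2, h1, ⟨c, h2, _⟩, ⟨c', h3, _⟩⟩ := h
  have := desc_range h2
  have := desc_range h3
  omega

theorem card_right {T : SDecTree n s} {x y : ℕ} (h : T.LeftOf y x) (hxy : x < y) :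
    T.card y x = s y := by
  have hr := leftOf_range h
  rw [card, dif_neg, if_pos]
  · exact ⟨by omega, by omega, by omega, fun h' => leftOf_irrefl (leftOf_trans h h')⟩
  · rintro ⟨j, hj⟩
    exact (leftOf_not_desc h).2 (inSub_desc hj (by omega)).1

theorem card_out (T : SDecTree n s) {x y : ℕ} (h : ¬ (1 ≤ x ∧ x < y ∧ y ≤ n)) :
    T.card y x = 0 := by
  by_cases hex : ∃ j, T.InSub y j x
  · obtain ⟨j, hj⟩ := hex
    rw [card_inSub hj]
    rcases Nat.eq_zero_or_pos y with rfl | hy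
    · exact inSub_zero hj
    · have h1 := inSub_desc hj hy
      have := desc_range h1.1
      omega
  · rw [card, dif_neg hex, if_neg]
    tauto

theorem card_le (T : SDecTree n s) (y x : ℕ) : T.card y x ≤ s y := by
  by_cases h : 1 ≤ x ∧ x < y ∧ y ≤ n
  · rcases T.trichotomy h.1 h.2.1 h.2.2 with h1 | h1 | h1
    · obtain ⟨j, hj⟩ := desc_child h1 h.2.1
      rw [card_inSub hj]
      exact (inSub_desc hj (by omega)).2.2
    · rw [card_left h1 h.2.1]; omega
    · rw [card_right h1 h.2.1]
  · rw [T.card_out h]; omega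

theorem leftOf_card_le {T : SDecTree n s} {u v z : ℕ} (h : T.LeftOf u v) (hu : u < z)
    (hv : v < z) (hz : z ≤ n) : T.card z u ≤ T.card z v := by
  have hr := leftOf_range h
  rcases T.trichotomy hr.1.1 hu hz with h1 | h1 | h1
  · obtain ⟨j, hj⟩ := desc_child h1 hu
    rw [card_inSub hj]
    obtain ⟨w, j1, j2, hw, h2, h3, h4⟩ := leftOf_pos h
    rcases lt_trichotomy w z with hlt | rfl | hlt
    · have := inSub_of_desc (inSub_lift hj (inSub_desc h3 hw).1 hlt) (inSub_desc h4 hw).1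
      rw [card_inSub this]
    · rw [card_inSub h4, inSub_unique hj h3]; omega
    · rw [card_right ⟨w, j1, j2, h2, inSub_lift h3 h1 hlt, h4⟩ hv]
      exact (inSub_desc hj (by omega)).2.2
  · rw [card_left h1 hu]; omega
  · rw [card_right h1 hu, card_right (leftOf_trans h1 h) hv]

theorem desc_card_eq {T : SDecTree n s} {x y z : ℕ} (h : T.Descend x y) (hz : y < z) :
    T.card z x = T.card z y := by
  have hr := desc_range h
  have hle := desc_le h
  by_cases hn : z ≤ n
  · rcases T.trichotomy hr.2.2.1 hz hn with h1 | h1 | h1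
    · obtain ⟨j, hj⟩ := desc_child h1 hz
      rw [card_inSub hj, card_inSub (inSub_of_desc hj h)]
    · rw [card_left h1 hz]
      obtain ⟨w, j1, j2, h2, h3, h4⟩ := h1
      exact card_left ⟨w, j1, j2, h2, inSub_of_desc h3 h, h4⟩ (by omega)
    · rw [card_right h1 hz]
      obtain ⟨w, j1, j2, h2, h3, h4⟩ := h1
      exact card_right ⟨w, j1, j2, h2, h3, inSub_of_desc h4 h⟩ (by omega)
  · rw [T.card_out (by omega), T.card_out (by omega)]

end SDecTree

/-! ### Tree-inversion sets -/

/-- Tree-inversion sets: multiplicity functions that are transitive and planar. -/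
structure TreeInv (n : ℕ) (s : ℕ → ℕ) (I : ℕ → ℕ → ℕ) : Prop where
  le : ∀ y x, I y x ≤ s y
  out : ∀ y x, ¬ (1 ≤ x ∧ x < y ∧ y ≤ n) → I y x = 0
  trans : ∀ x y z, x < y → y < z → I y x ≠ 0 → I z y ≤ I z x
  planar : ∀ x y z, 1 ≤ x → x < y → y < z → z ≤ n → I y x ≠ s y → I z x ≤ I z y

/-- Descent relation read off from the inversion set. -/
def InvDesc (n : ℕ) (I : ℕ → ℕ → ℕ) (x y : ℕ) : Prop :=
  1 ≤ x ∧ x ≤ y ∧ y ≤ n ∧ ∀ z, y < z → I z x = I z y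

theorem SDecTree.treeInv {n : ℕ} {s : ℕ → ℕ} (T : SDecTree n s) : TreeInv n s T.card where
  le := T.card_le
  out := fun y x h => T.card_out h
  trans := by
    intro x y z hxy hyz h0
    by_cases hz : z ≤ n
    · have hx : 1 ≤ x := by
        by_contra hx
        exact h0 (T.card_out (by omega))
      rcases T.trichotomy hx hxy (by omega) with h1 | h1 | h1
      · rw [desc_card_eq h1 hyz]
      · exact absurd (card_left h1 hxy) h0
      · exact leftOf_card_le h1 hyz (by omega) hz
    · rw [T.card_out (by omega)]; omega
  planar := by
    intro x y z hx hxy hyz hz h0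
    rcases T.trichotomy hx hxy (by omega) with h1 | h1 | h1
    · rw [desc_card_eq h1 hyz]
    · exact leftOf_card_le h1 (by omega) hyz hz
    · exact absurd (card_right h1 hxy) h0

theorem SDecTree.desc_iff {n : ℕ} {s : ℕ → ℕ} (T : SDecTree n s) (x y : ℕ) :
    T.Descend x y ↔ InvDesc n T.card x y := by
  constructor
  · intro h
    have := desc_range h
    exact ⟨this.1, desc_le h, this.2.2.2, fun z hz => desc_card_eq h hz⟩
  · rintro ⟨h1, h2, h3, h4⟩
    rcases h2.eq_or_lt with rfl | h5
    · exact T.desc_refl h1 h3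
    · have key : ∀ {u v}, T.LeftOf u v → ∃ z, u < z ∧ v < z ∧ T.card z u < T.card z v := by
        intro u v h
        obtain ⟨z, j1, j2, hz, h6, h7, h8⟩ := leftOf_pos h
        refine ⟨z, (inSub_desc h7 hz).2.1, (inSub_desc h8 hz).2.1, ?_⟩
        rwa [card_inSub h7, card_inSub h8]
      rcases T.trichotomy h1 h5 h3 with h | h | h
      · exact h
      · obtain ⟨z, _, h6, h7⟩ := key h
        have := h4 z h6
        omega
      · obtain ⟨z, h6, _, h7⟩ := key h
        have := h4 z h6
        omega

theorem SDecTree.inSub_iff {n : ℕ} {s : ℕ → ℕ} (T : SDecTree n s) {y j x : ℕ} (hy : 1 ≤ y) :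
    T.InSub y j x ↔ InvDesc n T.card x y ∧ x < y ∧ T.card y x = j := by
  rw [← T.desc_iff]
  constructor
  · intro h
    have := inSub_desc h hy
    exact ⟨this.1, this.2.1, card_inSub h⟩
  · rintro ⟨h1, h2, rfl⟩
    obtain ⟨j, hj⟩ := desc_child h1 h2
    rwa [card_inSub hj]

namespace TreeInv

variable {n : ℕ} {s : ℕ → ℕ} {I : ℕ → ℕ → ℕ}

theorem key (h : TreeInv n s I) {v w z : ℕ} (hv : 1 ≤ v) (hw : 1 ≤ w) (hvz : v < z)
    (hwz : w < z) (hz : z ≤ n) (heq : ∀ z', z < z' → I z' v = I z' w) (hne : I z v ≠ I z w) :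
    InvDesc n I w z := by
  refine ⟨hw, hwz.le, hz, fun z' hz' => ?_⟩
  by_contra hcon
  have e := heq z' hz'
  rcases lt_or_gt_of_ne hcon with hlt | hlt
  · have h1 := h.trans w z z' hwz hz'
    have h2 := h.trans v z z' hvz hz'
    by_cases h3 : I z w = 0
    · have := h2 (by omega)
      omega
    · have := h1 h3
      omega
  · have hn : z' ≤ n := by
      by_contra hn
      have := h.out z' w (by omega)
      omega
    have h1 := h.planar w z z' hw hwz hz' hn
    have h2 := h.planar v z z' hv hvz hz' hn
    by_cases h3 : I z w = s z
    · have := h2 (by omega)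
      omega
    · have := h1 h3
      omega

/-- Two incomparable vertices have a meeting vertex. -/
theorem meet (h : TreeInv n s I) {x y : ℕ} (hx : 1 ≤ x) (hxy : x < y) (hy : y ≤ n)
    (hd : ¬ InvDesc n I x y) :
    ∃ z, y < z ∧ z ≤ n ∧ InvDesc n I x z ∧ InvDesc n I y z ∧ I z x ≠ I z y := by
  have hex : ∃ z, y < z ∧ I z x ≠ I z y := by
    by_contra hcon
    push Not at hcon
    exact hd ⟨hx, hxy.le, hy, hcon⟩
  have hb : ∀ z, (y < z ∧ I z x ≠ I z y) → z ≤ n := by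
    intro z hz
    by_contra hn
    rw [h.out z x (by omega), h.out z y (by omega)] at hz
    exact hz.2 rfl
  obtain ⟨z0, hz0⟩ := hex
  have h1 := Nat.findGreatest_spec (P := fun z => y < z ∧ I z x ≠ I z y) (hb z0 hz0) hz0
  have h2 : ∀ z', Nat.findGreatest (fun z => y < z ∧ I z x ≠ I z y) n < z' →
      I z' x = I z' y := by
    intro z' hz'
    by_contra hcon
    have h3 : y < z' ∧ I z' x ≠ I z' y := ⟨by omega, hcon⟩
    exact Nat.findGreatest_is_greatest hz' (hb z' h3) h3
  set z := Nat.findGreatest (fun z => y < z ∧ I z x ≠ I z y) n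
  have hzn := hb z h1
  exact ⟨z, h1.1, hzn,
    h.key (by omega) hx h1.1 (by omega) hzn (fun z' hz' => (h2 z' hz').symm) h1.2.symm,
    h.key hx (by omega) (by omega) h1.1 hzn h2 h1.2, h1.2⟩

theorem invDesc_trans {x y z : ℕ} (h1 : InvDesc n I x y) (h2 : InvDesc n I y z) :
    InvDesc n I x z := by
  obtain ⟨a1, a2, a3, a4⟩ := h1
  obtain ⟨b1, b2, b3, b4⟩ := h2
  exact ⟨a1, by omega, b3, fun w hw => by rw [a4 w (by omega), b4 w hw]⟩

theorem invDesc_total {x y z : ℕ} (h1 : InvDesc n I x y) (h2 : InvDesc n I x z) (hyz : y ≤ z) :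
    InvDesc n I y z := by
  obtain ⟨a1, a2, a3, a4⟩ := h1
  obtain ⟨b1, b2, b3, b4⟩ := h2
  exact ⟨by omega, hyz, b3, fun w hw => by rw [← a4 w (by omega), b4 w hw]⟩

theorem root (h : TreeInv n s I) {x : ℕ} (h1 : 1 ≤ x) (h2 : x ≤ n) : InvDesc n I x n :=
  ⟨h1, h2, le_rfl, fun z hz => by rw [h.out z x (by omega), h.out z n (by omega)]⟩

theorem exists_parent (h : TreeInv n s I) {v : ℕ} (h1 : 1 ≤ v) (h2 : v < n) :
    ∃ p, v < p ∧ InvDesc n I v p := ⟨n, h2, h.root h1 h2.le⟩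

/-- The parent function of the tree associated to a tree-inversion set. -/
noncomputable def par (h : TreeInv n s I) (v : ℕ) : ℕ :=
  if hv : 1 ≤ v ∧ v < n then Nat.find (h.exists_parent hv.1 hv.2) else 0

theorem par_spec (h : TreeInv n s I) {v : ℕ} (h1 : 1 ≤ v) (h2 : v < n) :
    v < h.par v ∧ InvDesc n I v (h.par v) ∧
      ∀ p, v < p → InvDesc n I v p → h.par v ≤ p := by
  rw [par, dif_pos ⟨h1, h2⟩]
  have hs := Nat.find_spec (h.exists_parent h1 h2)
  exact ⟨hs.1, hs.2, fun p hp hd => Nat.find_min' _ ⟨hp, hd⟩⟩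

theorem par_out (h : TreeInv n s I) {v : ℕ} (h1 : v = 0 ∨ n ≤ v) : h.par v = 0 := by
  rw [par, dif_neg]
  omega

theorem slot (h : TreeInv n s I) {v w : ℕ} (hv : 1 ≤ v) (hvw : v < w) (hw : w < n)
    (hp : h.par v = h.par w) (hi : I (h.par v) v = I (h.par w) w) : False := by
  obtain ⟨a1, a2, a3⟩ := h.par_spec hv (by omega)
  obtain ⟨b1, b2, b3⟩ := h.par_spec (v := w) (by omega) hw
  by_cases hd : InvDesc n I v w
  · have := a3 w hvw hd
    omega
  · obtain ⟨z, c1, c2, c3, c4, c5⟩ := h.meet hv hvw hw.le hd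
    have h1 := b3 z c1 c4
    rw [hp] at hi a2
    rcases h1.eq_or_lt with h2 | h2
    · rw [h2] at hi
      exact c5 hi
    · rw [a2.2.2.2 z h2, b2.2.2.2 z h2] at c5
      exact c5 rfl

/-- The tree associated to a tree-inversion set. -/
noncomputable def tree (h : TreeInv n s I) : SDecTree n s where
  parent := h.par
  idx := fun v => I (h.par v) v
  parent_gt := fun v h1 h2 => (h.par_spec h1 h2).1
  parent_le := fun v h1 h2 => (h.par_spec h1 h2).2.1.2.2.1
  idx_le := fun v _ _ => h.le _ _
  slot_inj := by
    intro v w h1 h2 h3 h4 hp hi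
    rcases lt_trichotomy v w with h5 | h5 | h5
    · exact (h.slot h1 h5 h4 hp hi).elim
    · exact h5
    · exact (h.slot h3 h5 h2 hp.symm hi.symm).elim
  parent_out := fun v hv => h.par_out hv
  idx_out := fun v hv => h.out _ _ (by rw [h.par_out hv]; omega)

theorem tree_desc_of (h : TreeInv n s I) {x y : ℕ} (hd : InvDesc n I x y) :
    h.tree.Descend x y := by
  obtain ⟨k, hk⟩ : ∃ k, k = y - x := ⟨_, rfl⟩
  induction k using Nat.strong_induction_on generalizing x with
  | _ k ih =>
    obtain ⟨h1, h2, h3, h4⟩ := id hd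
    rcases h2.eq_or_lt with rfl | h5
    · exact h.tree.desc_refl h1 h3
    · obtain ⟨a1, a2, a3⟩ := h.par_spec h1 (by omega)
      have a4 := a3 y h5 hd
      exact SDecTree.desc_trans (h.tree.desc_parent h1 (by omega))
        (ih (y - h.par x) (by omega) (invDesc_total a2 hd a4) rfl)

theorem of_tree_desc (h : TreeInv n s I) {x y : ℕ} (hd : h.tree.Descend x y) :
    InvDesc n I x y := by
  obtain ⟨k, hk, hm⟩ := hd
  induction k generalizing y with
  | zero =>
    have := hm 0 le_rfl
    simp at hk this
    subst hk
    exact ⟨this.1, le_rfl, this.2, fun _ _ => rfl⟩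
  | succ k ih =>
    have h1 := ih rfl (fun m hmk => hm m (by omega))
    rw [Function.iterate_succ_apply'] at hk
    have h2 := hm (k+1) le_rfl
    rw [Function.iterate_succ_apply'] at h2
    have h3 := h.tree.parent_pos_lt h2.1
    have h4 := h.par_spec h3.1 h3.2
    rw [← hk]
    exact invDesc_trans h1 h4.2.1

theorem tree_inSub (h : TreeInv n s I) {x y : ℕ} (hd : InvDesc n I x y) (hxy : x < y) :
    h.tree.InSub y (I y x) x := by
  obtain ⟨j, c, hc, hp, hi⟩ := SDecTree.desc_child (h.tree_desc_of hd) hxy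
  refine ⟨c, hc, hp, ?_⟩
  have h1 := h.tree.parent_pos_lt (c := c) (by omega)
  have h2 := h.tree.parent_gt c h1.1 h1.2
  have h3 := (h.of_tree_desc hc).2.2.2 y (by omega)
  rw [h3, ← hp]
  rfl

theorem tree_card (h : TreeInv n s I) (y x : ℕ) : h.tree.card y x = I y x := by
  by_cases hr : 1 ≤ x ∧ x < y ∧ y ≤ n
  · obtain ⟨h1, h2, h3⟩ := hr
    by_cases hd : InvDesc n I x y
    · exact SDecTree.card_inSub (h.tree_inSub hd h2)
    · obtain ⟨z, c1, c2, c3, c4, c5⟩ := h.meet h1 h2 h3 hd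
      have i1 := h.tree_inSub c3 (by omega)
      have i2 := h.tree_inSub c4 (by omega)
      rcases lt_or_gt_of_ne c5 with hlt | hlt
      · rw [SDecTree.card_left ⟨z, _, _, hlt, i1, i2⟩ h2]
        by_contra h0
        have := h.trans x y z h2 c1 (Ne.symm h0)
        omega
      · rw [SDecTree.card_right ⟨z, _, _, hlt, i2, i1⟩ h2]
        by_contra h0
        have := h.planar x y z h1 h2 c1 c2 (Ne.symm h0)
        omega
  · rw [h.tree.card_out hr, h.out y x hr]

end TreeInv

/-! ### Ascents and the explicit join -/

/-- A tree ascent, expressed through the inversion set. -/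
structure Asc (n : ℕ) (s : ℕ → ℕ) (I : ℕ → ℕ → ℕ) (a b : ℕ) : Prop where
  pos : 1 ≤ a
  lt : a < b
  desc : InvDesc n I a b
  lts : I b a < s b
  mid : ∀ e, a < e → e < b → InvDesc n I a e → I e a = s e

/-- The labeled vertices of `T^a ∖ 0`, through the inversion set. -/
def SubM (n : ℕ) (I : ℕ → ℕ → ℕ) (a x : ℕ) : Prop :=
  x = a ∨ (x < a ∧ InvDesc n I x a ∧ I a x ≠ 0)

namespace Asc

variable {n : ℕ} {s : ℕ → ℕ} {I : ℕ → ℕ → ℕ} {a b c d : ℕ}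

theorem subM_desc (h : Asc n s I a b) {x : ℕ} (hx : SubM n I a x) : InvDesc n I x a := by
  rcases hx with rfl | hx
  · exact ⟨h.pos, le_rfl, by have := h.lt; have := h.desc.2.2.1; omega, fun _ _ => rfl⟩
  · exact hx.2.1

theorem t1 (h : Asc n s I a b) (hI : TreeInv n s I) {x y : ℕ} (hy : SubM n I a y) (hxy : x < y)
    (h0 : I y x ≠ 0) (hb : I b x = I b y) : SubM n I a x := by
  have hya := h.subM_desc hy
  have hab := h.lt
  have hbn := h.desc.2.2.1
  have hx : 1 ≤ x := by
    by_contra hx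
    exact h0 (hI.out _ _ (by omega))
  have hle := hya.2.1
  have hax : I a x ≠ 0 := by
    rcases hy with rfl | hy
    · exact h0
    · have := hI.trans x y a hxy hy.1 h0
      have := hy.2.2
      omega
  have hba : I b x = I b a := by rw [hb]; exact hya.2.2.2 b hab
  refine Or.inr ⟨by omega, ?_, hax⟩
  by_contra hd
  obtain ⟨z, c1, c2, c3, c4, c5⟩ := hI.meet hx (by omega) (by omega) hd
  have h1 := hI.trans x a z (by omega) c1 hax
  rcases lt_trichotomy z b with hz | rfl | hz
  · have h2 := h.mid z c1 hz c4
    have := hI.le z x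
    omega
  · exact c5 hba
  · have h2 := h.desc.2.2.2 z hz
    have h3 := hI.planar x b z hx (by omega) hz c2 (by have := h.lts; omega)
    omega

theorem t2 (h : Asc n s I a b) (hI : TreeInv n s I) {x y : ℕ} (hx : SubM n I a x) (hxy : x < y)
    (hyb : y < b) (h0 : I y x ≠ s y) (hb : I b y = I b x) : SubM n I a y := by
  have hxa := h.subM_desc hx
  have hab := h.lt
  have hbn := h.desc.2.2.1
  have hle := hxa.2.1
  have hba : I b y = I b a := by rw [hb]; exact hxa.2.2.2 b hab
  rcases lt_trichotomy y a with hya | rfl | hya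
  · have h1 : I a x ≠ 0 := by
      rcases hx with rfl | hx
      · omega
      · exact hx.2.2
    have h2 := hI.planar x y a hxa.1 hxy hya (by omega) h0
    exact h.t1 hI (Or.inl rfl) hya (by omega) hba
  · exact Or.inl rfl
  · exfalso
    have hyx : I y a ≠ s y := by rw [← hxa.2.2.2 y hya]; exact h0
    by_cases hd : InvDesc n I a y
    · exact hyx (h.mid y hya hyb hd)
    · obtain ⟨z, c1, c2, c3, c4, c5⟩ := hI.meet h.pos hya (by omega) hd
      have h1 := hI.planar a y z h.pos hya c1 c2 hyx
      rcases lt_trichotomy z b with hz | rfl | hz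
      · have h2 := h.mid z (by omega) hz c3
        have := hI.le z y
        omega
      · exact c5 hba.symm
      · have h2 := h.desc.2.2.2 z hz
        have h3 := hI.planar y b z (by omega) hyb hz c2 (by have := h.lts; omega)
        omega

end Asc

/-- The inversions added in the join. -/
def Added (n : ℕ) (I : ℕ → ℕ → ℕ) (a b c d z x : ℕ) : Prop :=
  (z = b ∧ SubM n I a x) ∨ (z = d ∧ SubM n I c x) ∨
    (z = d ∧ b = c ∧ I c a = 0 ∧ SubM n I a x)

/-- The inversion set of the join. -/
noncomputable def joinInv (n : ℕ) (I : ℕ → ℕ → ℕ) (a b c d : ℕ) : ℕ → ℕ → ℕ := fun z x =>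
  I z x + if Added n I a b c d z x then 1 else 0

theorem added_desc {n : ℕ} {s : ℕ → ℕ} {I : ℕ → ℕ → ℕ} {a b c d : ℕ}
    (h : Asc n s I a b) (h' : Asc n s I c d) {z x : ℕ}
    (hP : Added n I a b c d z x) : InvDesc n I x z ∧ x < z ∧ I z x < s z := by
  have key : ∀ {a b x}, Asc n s I a b → InvDesc n I x a →
      InvDesc n I x b ∧ x < b ∧ I b x < s b := by
    intro a b x h hx
    have := h.lt
    have := hx.2.1
    exact ⟨TreeInv.invDesc_trans hx h.desc, by omega, by rw [hx.2.2.2 b h.lt]; exact h.lts⟩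
  rcases hP with ⟨rfl, h1⟩ | ⟨rfl, h1⟩ | ⟨rfl, rfl, h0, h1⟩
  · exact key h (h.subM_desc h1)
  · exact key h' (h'.subM_desc h1)
  · exact key h' (TreeInv.invDesc_trans (h.subM_desc h1) h.desc)

theorem join_treeInv {n : ℕ} {s : ℕ → ℕ} {I : ℕ → ℕ → ℕ} {a b c d : ℕ} (hI : TreeInv n s I)
    (hac : a < c) (h : Asc n s I a b) (h' : Asc n s I c d) :
    TreeInv n s (joinInv n I a b c d) where
  le := by
    intro y x
    unfold joinInv
    split_ifs with hP
    · exact (added_desc h h' hP).2.2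
    · exact hI.le y x
  out := by
    intro y x hr
    unfold joinInv
    rw [hI.out y x hr, if_neg]
    intro hP
    obtain ⟨h1, h2, _⟩ := added_desc h h' hP
    exact hr ⟨h1.1, h2, h1.2.2.1⟩
  trans := by
    intro x y z hxy hyz h0
    by_cases hyx : I y x = 0
    · have hP : Added n I a b c d y x := by
        by_contra hP
        simp [joinInv, hyx, hP] at h0
      obtain ⟨hD, _, _⟩ := added_desc h h' hP
      have heq := hD.2.2.2 z hyz
      have himp : Added n I a b c d z y → Added n I a b c d z x := by
        have hcd := h'.lt
        have hab := h.lt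
        intro hQ
        have hlow : ∀ {u v}, Asc n s I u v → SubM n I u y → y ≤ u :=
          fun hu hy => (hu.subM_desc hy).2.1
        rcases hP with ⟨rfl, h1⟩ | ⟨rfl, h1⟩ | ⟨rfl, h2, h3, h1⟩
        · rcases hQ with ⟨rfl, h4⟩ | ⟨rfl, h4⟩ | ⟨rfl, h5, h6, h4⟩
          · omega
          · rcases h4 with rfl | h4
            · refine Or.inr (Or.inr ⟨rfl, rfl, ?_, h1⟩)
              rw [← (h.subM_desc h1).2.2.2 y hab]; exact hyx
            · refine Or.inr (Or.inl ⟨rfl, Or.inr ⟨by omega,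
                TreeInv.invDesc_trans hD h4.2.1, ?_⟩⟩)
              rw [hD.2.2.2 c h4.1]; exact h4.2.2
          · have := hlow h h4
            omega
        all_goals
          rcases hQ with ⟨rfl, h4⟩ | ⟨rfl, h4⟩ | ⟨rfl, h5, h6, h4⟩
          · have := hlow h h4
            omega
          · omega
          · omega
      unfold joinInv
      by_cases hQ : Added n I a b c d z y
      · rw [if_pos hQ, if_pos (himp hQ), heq]
      · rw [if_neg hQ, heq]; omega
    · have h1 := hI.trans x y z hxy hyz hyx
      unfold joinInv
      by_cases hQ : Added n I a b c d z y
      · by_cases hlt : I z y < I z x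
        · split_ifs <;> omega
        · have heq : I z x = I z y := by omega
          have : Added n I a b c d z x := by
            rcases hQ with ⟨rfl, h4⟩ | ⟨rfl, h4⟩ | ⟨rfl, rfl, h6, h4⟩
            · exact Or.inl ⟨rfl, h.t1 hI h4 hxy hyx heq⟩
            · exact Or.inr (Or.inl ⟨rfl, h'.t1 hI h4 hxy hyx heq⟩)
            · have hya := h.subM_desc h4
              have hyb := TreeInv.invDesc_trans hya h.desc
              have hle := hya.2.1
              by_cases hbx : I b x = 0
              · refine Or.inr (Or.inr ⟨rfl, rfl, h6, h.t1 hI h4 hxy hyx ?_⟩)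
                rw [hya.2.2.2 b hac, hbx, h6]
              · exact Or.inr (Or.inl ⟨rfl, h'.t1 hI (Or.inl rfl) (by omega) hbx
                  (by rw [heq, hyb.2.2.2 z h'.lt])⟩)
          rw [if_pos hQ, if_pos this]
          omega
      · split_ifs <;> omega
  planar := by
    intro x y z hx hxy hyz hz h0
    by_cases hyx : I y x = s y
    · exfalso
      apply h0
      unfold joinInv
      rw [if_neg, hyx]
      · omega
      · intro hP
        have := (added_desc h h' hP).2.2
        omega
    · have h1 := hI.planar x y z hx hxy hyz hz hyx
      unfold joinInv
      by_cases hQ : Added n I a b c d z x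
      · by_cases hlt : I z x < I z y
        · split_ifs <;> omega
        · have heq : I z y = I z x := by omega
          have : Added n I a b c d z y := by
            rcases hQ with ⟨rfl, h4⟩ | ⟨rfl, h4⟩ | ⟨rfl, rfl, h6, h4⟩
            · exact Or.inl ⟨rfl, h.t2 hI h4 hxy hyz hyx heq⟩
            · exact Or.inr (Or.inl ⟨rfl, h'.t2 hI h4 hxy hyz hyx heq⟩)
            · have hxa := h.subM_desc h4
              have hxb := TreeInv.invDesc_trans hxa h.desc
              have hzy : I z y = I z b := by rw [heq, hxb.2.2.2 z h'.lt]
              rcases lt_trichotomy y b with hy | rfl | hy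
              · by_cases hby : I b y = 0
                · refine Or.inr (Or.inr ⟨rfl, rfl, h6, h.t2 hI h4 hxy hy hyx ?_⟩)
                  rw [hxa.2.2.2 b hac, hby, h6]
                · exact Or.inr (Or.inl ⟨rfl, h'.t1 hI (Or.inl rfl) hy hby hzy⟩)
              · exact Or.inr (Or.inl ⟨rfl, Or.inl rfl⟩)
              · refine Or.inr (Or.inl ⟨rfl, h'.t2 hI (Or.inl rfl) hy hyz ?_ hzy⟩)
                rw [← hxb.2.2.2 y hy]; exact hyx
          rw [if_pos hQ, if_pos this]
          omega
      · split_ifs <;> omega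

/-! ### The rotation, explicitly -/

theorem tc_eq {n : ℕ} {s : ℕ → ℕ} {I : ℕ → ℕ → ℕ} {a b : ℕ} (hI : TreeInv n s I)
    (h : Asc n s I a b) (y x : ℕ) :
    tcInv (addInv s I b a) y x = I y x + if y = b ∧ SubM n I a x then 1 else 0 := by
  have hlts := h.lts
  apply le_antisymm
  · apply Nat.sInf_le
    refine ⟨fun y x => I y x + if y = b ∧ SubM n I a x then 1 else 0, ?_, ?_, rfl⟩
    · intro x y z hxy hyz
      by_cases hyx : I y x = 0
      · by_cases hP : y = b ∧ SubM n I a x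
        · right
          obtain ⟨rfl, hP⟩ := hP
          have hD := TreeInv.invDesc_trans (h.subM_desc hP) h.desc
          have := hD.2.2.2 z hyz
          simp only [show ¬ (z = y ∧ SubM n I a y) by omega, if_false]
          omega
        · left
          simp [hyx, hP]
      · right
        have h1 := hI.trans x y z hxy hyz hyx
        by_cases hP : z = b ∧ SubM n I a y
        · obtain ⟨rfl, hP⟩ := hP
          by_cases hlt : I z y < I z x
          · dsimp only
            split_ifs <;> omega
          · have := h.t1 hI hP hxy hyx (by omega)
            simp only [this, hP, and_self, if_true]
            omega
        · simp only [hP, if_false]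
          omega
    · intro y x
      unfold addInv
      by_cases hyx : y = b ∧ x = a
      · obtain ⟨rfl, rfl⟩ := hyx
        have : SubM n I x x := Or.inl rfl
        simp [this]
      · rw [if_neg hyx]
        exact Nat.le_add_right _ _
  · apply le_csInf
    · refine ⟨_, fun y x => s y, fun _ _ _ _ _ => Or.inr le_rfl, ?_, rfl⟩
      intro y x
      unfold addInv
      split_ifs
      · exact min_le_right _ _
      · exact hI.le y x
    · rintro m ⟨J, hJ, hle, rfl⟩
      have hge : ∀ y x, I y x ≤ J y x := by
        intro y x
        have := hle y x
        unfold addInv at this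
        have := hI.le y x
        split_ifs at * <;> omega
      split_ifs with hP
      · obtain ⟨rfl, hP⟩ := hP
        have h1 := hle y a
        simp only [addInv, and_self, if_true] at h1
        have h2 : I y a + 1 ≤ J y a := by omega
        rcases hP with rfl | ⟨hP1, hP2, hP3⟩
        · exact h2
        · have h3 := hge a x
          have h4 := hP2.2.2.2 y h.lt
          rcases hJ x a y hP1 h.lt with h5 | h5
          · omega
          · omega
      · exact hge y x

theorem SDecTree.asc_of {n : ℕ} {s : ℕ → ℕ} {T : SDecTree n s} {a b : ℕ}
    (h : T.TreeAscent a b) : Asc n s T.card a b := by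
  obtain ⟨h1, h2, h3, ⟨i, hi, hs⟩, h4, _⟩ := h
  have h5 := (T.inSub_iff (by omega)).1 hs
  refine ⟨h1, h2, h5.1, by omega, fun e he1 he2 hD => ?_⟩
  exact h4 e _ he1 he2 ((T.inSub_iff (by omega)).2 ⟨hD, he1, rfl⟩)

theorem SDecTree.subM_iff {n : ℕ} {s : ℕ → ℕ} {T : SDecTree n s} {a x : ℕ} (ha : 1 ≤ a) :
    T.InSubMinus0 a x ↔ SubM n T.card a x := by
  unfold InSubMinus0 SubM
  constructor
  · rintro (h | ⟨j, hj, h⟩)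
    · exact Or.inl h
    · have := (T.inSub_iff ha).1 h
      exact Or.inr ⟨this.2.1, this.1, by omega⟩
  · rintro (h | ⟨h1, h2, h3⟩)
    · exact Or.inl h
    · exact Or.inr ⟨_, by omega, (T.inSub_iff ha).2 ⟨h2, h1, rfl⟩⟩

theorem SDecTree.rot_card {n : ℕ} {s : ℕ → ℕ} {T Z : SDecTree n s} {a b : ℕ}
    (h : T.IsRotation Z a b) (y x : ℕ) :
    Z.card y x = T.card y x + if y = b ∧ SubM n T.card a x then 1 else 0 := by
  have hA := asc_of h.1
  by_cases hr : 1 ≤ x ∧ x < y ∧ y ≤ n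
  · rw [h.2 y x hr.1 hr.2.1 hr.2.2, tc_eq T.treeInv hA]
  · rw [Z.card_out hr, T.card_out hr, if_neg]
    rintro ⟨rfl, hS⟩
    have h1 := hA.subM_desc hS
    have := hA.lt
    have := h1.2.1
    exact hr ⟨h1.1, by omega, hA.desc.2.2.1⟩

/-- the multi-inversion set difference `inv (Z ∨ Q) − inv T` equals (as a
multiset, i.e. with multiplicities given by the indicator) the union
`A_T(a,b) ∪ A_T(c,d) ∪ F_T(a,c)`. -/
theorem added_inversion_set_charact (n : ℕ) (s : ℕ → ℕ) (T Z Q W : SDecTree n s)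
    (a b c d : ℕ) (hac : a < c)
    (hZ : SDecTree.IsRotation T Z a b) (hQ : SDecTree.IsRotation T Q c d)
    (hW : SDecTree.IsJoin Z Q W) :
    ∀ f e, 1 ≤ e → e < f → f ≤ n →
      W.card f e - T.card f e =
        Set.indicator
          (SDecTree.Aset T Z ∪ SDecTree.Aset T Q ∪ SDecTree.Fset T a b c d)
          (fun _ => 1) (f, e) := by
  intro f e he hef hf
  have hA := SDecTree.asc_of hZ.1
  have hC := SDecTree.asc_of hQ.1
  have hJ := join_treeInv T.treeInv hac hA hC
  have hZc := SDecTree.rot_card hZ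
  have hQc := SDecTree.rot_card hQ
  obtain ⟨w1, w2, w3⟩ := hW
  have hWc : W.card f e = joinInv n T.card a b c d f e := by
    apply le_antisymm
    · rw [← hJ.tree_card]
      apply w3
      · intro y x
        rw [hJ.tree_card, hZc]
        unfold joinInv
        by_cases hP : y = b ∧ SubM n T.card a x
        · rw [if_pos hP, if_pos (show Added n T.card a b c d y x from Or.inl hP)]
        · rw [if_neg hP]; omega
      · intro y x
        rw [hJ.tree_card, hQc]
        unfold joinInv
        by_cases hP : y = d ∧ SubM n T.card c x
        · rw [if_pos hP, if_pos (show Added n T.card a b c d y x from Or.inr (Or.inl hP))]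
        · rw [if_neg hP]; omega
    · unfold joinInv
      have z1 := w1 f e
      have q1 := w2 f e
      rw [hZc] at z1
      rw [hQc] at q1
      split_ifs with hP
      · rcases hP with hP | hP | ⟨rfl, rfl, h0, hP⟩
        · rwa [if_pos hP] at z1
        · rwa [if_pos hP] at q1
        · have hD := TreeInv.invDesc_trans (hA.subM_desc hP) hA.desc
          have h1 := w1 b e
          rw [hZc, if_pos ⟨rfl, hP⟩] at h1
          have h2 := w2 f b
          rw [hQc, if_pos ⟨rfl, Or.inl rfl⟩] at h2
          have h3 := hD.2.2.2 f hC.lt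
          have h4 := (hA.subM_desc hP).2.1
          have := W.treeInv.trans e b f (by omega) hC.lt (by omega)
          omega
      · omega
  have hmem : (f, e) ∈ (SDecTree.Aset T Z ∪ SDecTree.Aset T Q ∪ SDecTree.Fset T a b c d) ↔
      Added n T.card a b c d f e := by
    have e1 : (f, e) ∈ SDecTree.Aset T Z ↔ f = b ∧ SubM n T.card a e := by
      show T.card f e < Z.card f e ↔ _
      rw [hZc]
      split_ifs with hP <;> simp [hP]
    have e2 : (f, e) ∈ SDecTree.Aset T Q ↔ f = d ∧ SubM n T.card c e := by
      show T.card f e < Q.card f e ↔ _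
      rw [hQc]
      split_ifs with hP <;> simp [hP]
    have e3 : (f, e) ∈ SDecTree.Fset T a b c d ↔
        f = d ∧ b = c ∧ T.card c a = 0 ∧ SubM n T.card a e := by
      show (b = c ∧ T.InSub c 0 a ∧ f = d ∧ T.InSubMinus0 a e) ↔ _
      rw [SDecTree.subM_iff hA.pos, T.inSub_iff hC.pos]
      constructor
      · rintro ⟨h1, h2, h3, h4⟩
        exact ⟨h3, h1, h2.2.2, h4⟩
      · rintro ⟨h1, rfl, h3, h4⟩
        exact ⟨rfl, ⟨hA.desc, hac, h3⟩, h1, h4⟩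
    rw [Set.mem_union, Set.mem_union, e1, e2, e3, or_assoc]
    rfl
  rw [hWc, joinInv, Nat.add_sub_cancel_left]
  by_cases hP : Added n T.card a b c d f e
  · rw [if_pos hP, Set.indicator_of_mem (hmem.2 hP)]
  · rw [if_neg hP, Set.indicator_of_notMem (fun hm => hP (hmem.1 hm))]
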